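/- Let V be a complex vector space of dimension n and let α, β be positive semidefinite Hermitian (1,1)-forms on V. If the Hermitian form α − β has at most one negative eigenvalue, then (α−β)^n ≥ α^n − n·α^{n−1}∧β as (n,n)-forms (i.e. the real number r with (α−β)^n = r·τ for a fixed positive volume form τ dominates the corresponding number for α^n − n·α^{n−1}∧β); and if α − β has at least two negative eigenvalues, then α^n − n·α^{n−1}∧β ≤ 0. Equivalently, the pointwise inequality 1_{X(α−β,≤1)}·(α−β)^n ≥ α^n − n·α^{n−1}∧β holds for positive (1,1)-forms α, β. -/

import Mathlib

open scoped ComplexOrder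

namespace Matrix

section ScalarInequalities

variable {ι : Type*} [DecidableEq ι]

lemma one_sub_sum_le_prod_one_sub (s : Finset ι) (f : ι → ℝ) (h0 : ∀ i ∈ s, 0 ≤ f i)
    (h1 : ∀ i ∈ s, f i ≤ 1) : 1 - ∑ i ∈ s, f i ≤ ∏ i ∈ s, (1 - f i) := by
  induction s using Finset.induction_on with
  | empty => simp
  | insert a s ha ih =>
    rw [Finset.sum_insert ha, Finset.prod_insert ha]
    have hs := ih (fun i hi => h0 i (Finset.mem_insert_of_mem hi))
      (fun i hi => h1 i (Finset.mem_insert_of_mem hi))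
    have hsum : 0 ≤ ∑ i ∈ s, f i :=
      Finset.sum_nonneg fun i hi => h0 i (Finset.mem_insert_of_mem hi)
    have ha0 := h0 a (Finset.mem_insert_self a s)
    have ha1 := h1 a (Finset.mem_insert_self a s)
    nlinarith [mul_le_mul_of_nonneg_left hs (sub_nonneg.2 ha1), mul_nonneg ha0 hsum]

lemma one_sub_sum_le_prod_one_sub_of_subsingleton [Fintype ι] (f : ι → ℝ) (h0 : ∀ i, 0 ≤ f i)
    (h1 : ∀ i j, 1 < f i → 1 < f j → i = j) : 1 - ∑ i, f i ≤ ∏ i, (1 - f i) := by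
  by_cases h : ∃ a, 1 < f a
  · obtain ⟨a, ha⟩ := h
    have hle : ∀ i ∈ Finset.univ.erase a, f i ≤ 1 := fun i hi => by
      by_contra! hi'
      exact Finset.ne_of_mem_erase hi (h1 i a hi' ha)
    rw [← Finset.add_sum_erase _ _ (Finset.mem_univ a),
      ← Finset.mul_prod_erase _ _ (Finset.mem_univ a)]
    have hsum : 0 ≤ ∑ i ∈ Finset.univ.erase a, f i := Finset.sum_nonneg fun i _ => h0 i
    have hprod : ∏ i ∈ Finset.univ.erase a, (1 - f i) ≤ 1 :=
      Finset.prod_le_one (fun i hi => sub_nonneg.2 (hle i hi)) fun i _ => by linarith [h0 i]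
    nlinarith
  · push Not at h
    exact one_sub_sum_le_prod_one_sub _ f (fun i _ => h0 i) fun i _ => h i

lemma one_add_sum_le_prod_one_add (s : Finset ι) (f : ι → ℝ) (h0 : ∀ i ∈ s, 0 ≤ f i) :
    1 + ∑ i ∈ s, f i ≤ ∏ i ∈ s, (1 + f i) := by
  induction s using Finset.induction_on with
  | empty => simp
  | insert a s ha ih =>
    rw [Finset.sum_insert ha, Finset.prod_insert ha]
    have hs := ih (fun i hi => h0 i (Finset.mem_insert_of_mem hi))
    have hsum : 0 ≤ ∑ i ∈ s, f i :=
      Finset.sum_nonneg fun i hi => h0 i (Finset.mem_insert_of_mem hi)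
    have ha0 := h0 a (Finset.mem_insert_self a s)
    nlinarith [mul_nonneg ha0 hsum]

end ScalarInequalities

variable {ι : Type*} [Fintype ι] [DecidableEq ι] {A B : Matrix ι ι ℂ}

/-- The Hermitian form of `Pᴴ D P` with `D` real diagonal is a weighted sum of squares. -/
lemma re_star_dotProduct_congr_diagonal_mulVec (P : Matrix ι ι ℂ) (d : ι → ℝ) (x : ι → ℂ) :
    (star x ⬝ᵥ ((Pᴴ * diagonal (fun i => (d i : ℂ)) * P) *ᵥ x)).re =
      ∑ i, d i * Complex.normSq ((P *ᵥ x) i) := by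
  rw [← mulVec_mulVec, ← mulVec_mulVec, dotProduct_mulVec, vecMul_conjTranspose, star_star]
  simp only [dotProduct, mulVec_diagonal, Pi.star_apply, Complex.re_sum]
  refine Finset.sum_congr rfl fun i _ => ?_
  simp [Complex.normSq_apply]
  ring

/-- Simultaneous diagonalization by congruence. -/
lemma PosDef.exists_congr_one_diagonal (hA : A.PosDef) (hB : B.PosSemidef) :
    ∃ (P : Matrix ι ι ℂ) (d : ι → ℝ), IsUnit P ∧ (∀ i, 0 ≤ d i) ∧ A = Pᴴ * P ∧
      B = Pᴴ * diagonal (fun i => (d i : ℂ)) * P := by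
  open scoped MatrixOrder in
  obtain ⟨S, hS, rfl⟩ := CStarAlgebra.isStrictlyPositive_iff_eq_star_mul_self.mp
    hA.isStrictlyPositive
  have hdet : IsUnit S.det := (isUnit_iff_isUnit_det S).1 hS
  have hC : (S⁻¹ᴴ * B * S⁻¹).PosSemidef := hB.conjTranspose_mul_mul_same S⁻¹
  have hSS : S⁻¹ * S = 1 := nonsing_inv_mul S hdet
  have hSS' : Sᴴ * S⁻¹ᴴ = 1 := by rw [← conjTranspose_mul, hSS, conjTranspose_one]
  let U : Matrix ι ι ℂ := hC.1.eigenvectorUnitary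
  have hUU : U * Uᴴ = 1 := Unitary.coe_mul_star_self hC.1.eigenvectorUnitary
  have hUU' : Uᴴ * U = 1 := Unitary.coe_star_mul_self hC.1.eigenvectorUnitary
  have hspec : S⁻¹ᴴ * B * S⁻¹ = U * diagonal (fun i => (hC.1.eigenvalues i : ℂ)) * Uᴴ := by
    conv_lhs => rw [hC.1.spectral_theorem]
    rfl
  refine ⟨Uᴴ * S, hC.1.eigenvalues, ?_, hC.eigenvalues_nonneg, ?_, ?_⟩
  · exact (IsUnit.of_mul_eq_one _ hUU').mul hS
  · rw [conjTranspose_mul, conjTranspose_conjTranspose, star_eq_conjTranspose, Matrix.mul_assoc,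
      ← Matrix.mul_assoc U, hUU, Matrix.one_mul]
  · calc B = (Sᴴ * S⁻¹ᴴ) * B * (S⁻¹ * S) := by rw [hSS, hSS', Matrix.one_mul, Matrix.mul_one]
      _ = Sᴴ * (S⁻¹ᴴ * B * S⁻¹) * S := by simp only [Matrix.mul_assoc]
      _ = Sᴴ * (U * diagonal (fun i => (hC.1.eigenvalues i : ℂ)) * Uᴴ) * S :=
        congrArg (fun C => Sᴴ * C * S) hspec
      _ = _ := by
        rw [conjTranspose_mul, conjTranspose_conjTranspose]
        simp only [Matrix.mul_assoc]

lemma add_smul_congr_diagonal (P : Matrix ι ι ℂ) (d : ι → ℝ) (t : ℝ) :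
    Pᴴ * P + t • (Pᴴ * diagonal (fun i => (d i : ℂ)) * P) =
      Pᴴ * diagonal (fun i => ((1 + t * d i : ℝ) : ℂ)) * P := by
  have : diagonal (fun i => ((1 + t * d i : ℝ) : ℂ)) =
      1 + t • diagonal (fun i => (d i : ℂ)) := by
    rw [← diagonal_one, ← diagonal_smul, diagonal_add]
    congr 1
    ext i
    simp
  rw [this, Matrix.mul_add, Matrix.add_mul, Matrix.mul_one, Matrix.mul_smul, Matrix.smul_mul]

lemma det_re_congr_diagonal (P : Matrix ι ι ℂ) (d : ι → ℝ) :
    (Pᴴ * diagonal (fun i => (d i : ℂ)) * P).det.re = Complex.normSq P.det * ∏ i, d i := by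
  have : (Pᴴ * diagonal (fun i => (d i : ℂ)) * P).det =
      ((Complex.normSq P.det * ∏ i, d i : ℝ) : ℂ) := by
    rw [det_mul, det_mul, det_diagonal, det_conjTranspose]
    push_cast
    rw [Complex.normSq_eq_conj_mul_self]
    simp only [RCLike.star_def]
    ring
  rw [this, Complex.ofReal_re]

lemma det_re_add_smul_congr_diagonal (P : Matrix ι ι ℂ) (d : ι → ℝ) (t : ℝ) :
    (Pᴴ * P + t • (Pᴴ * diagonal (fun i => (d i : ℂ)) * P)).det.re =
      Complex.normSq P.det * ∏ i, (1 + t * d i) := by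
  rw [add_smul_congr_diagonal, det_re_congr_diagonal]

/-- A Hermitian matrix with at most one negative eigenvalue is nonnegative on a hyperplane. -/
lemma IsHermitian.exists_re_nonneg_of_card_eigenvalues_neg_le_one (hA : A.IsHermitian)
    (h : Nat.card {i // hA.eigenvalues i < 0} ≤ 1) :
    ∃ e : ι → ℂ, ∀ x, e ⬝ᵥ x = 0 → 0 ≤ (star x ⬝ᵥ (A *ᵥ x)).re := by
  let U : Matrix ι ι ℂ := hA.eigenvectorUnitary
  have hspec : A = Uᴴᴴ * diagonal (fun i => (hA.eigenvalues i : ℂ)) * Uᴴ := by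
    rw [conjTranspose_conjTranspose]
    conv_lhs => rw [hA.spectral_theorem]
    rfl
  have hquad (x : ι → ℂ) : (star x ⬝ᵥ (A *ᵥ x)).re =
      ∑ i, hA.eigenvalues i * Complex.normSq ((Uᴴ *ᵥ x) i) := by
    rw [← re_star_dotProduct_congr_diagonal_mulVec, ← hspec]
  have hsub : Subsingleton {i // hA.eigenvalues i < 0} :=
    Finite.card_le_one_iff_subsingleton.1 h
  by_cases hneg : ∃ i₀, hA.eigenvalues i₀ < 0
  · obtain ⟨i₀, hi₀⟩ := hneg
    refine ⟨Uᴴ i₀, fun x hx => ?_⟩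
    rw [hquad]
    refine Finset.sum_nonneg fun i _ => ?_
    by_cases hi : hA.eigenvalues i < 0
    · obtain rfl : i = i₀ := congrArg Subtype.val (hsub.elim ⟨i, hi⟩ ⟨i₀, hi₀⟩)
      rw [show (Uᴴ *ᵥ x) i = 0 from hx]
      simp
    · exact mul_nonneg (not_lt.1 hi) (Complex.normSq_nonneg _)
  · push Not at hneg
    refine ⟨0, fun x _ => ?_⟩
    rw [hquad]
    exact Finset.sum_nonneg fun i _ => mul_nonneg (hneg i) (Complex.normSq_nonneg _)

/-- If `Pᴴ D P`, with `P` invertible and `D` real diagonal, is nonnegative on a hyperplane, then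
`D` has at most one negative entry. -/
lemma eq_of_congr_diagonal_nonneg_on_hyperplane {P : Matrix ι ι ℂ} (hP : IsUnit P) {d : ι → ℝ}
    {e : ι → ℂ}
    (he : ∀ x, e ⬝ᵥ x = 0 →
      0 ≤ (star x ⬝ᵥ ((Pᴴ * diagonal (fun i => (d i : ℂ)) * P) *ᵥ x)).re)
    {i j : ι} (hi : d i < 0) (hj : d j < 0) : i = j := by
  by_contra hij
  have hPP : P * P⁻¹ = 1 := mul_nonsing_inv P ((isUnit_iff_isUnit_det P).1 hP)
  obtain ⟨a, b, hab, h0⟩ : ∃ a b : ℂ, (a ≠ 0 ∨ b ≠ 0) ∧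
      a * (e ⬝ᵥ (P⁻¹ *ᵥ Pi.single i 1)) + b * (e ⬝ᵥ (P⁻¹ *ᵥ Pi.single j 1)) = 0 := by
    by_cases hu : e ⬝ᵥ (P⁻¹ *ᵥ Pi.single i 1) = 0
    · exact ⟨1, 0, by simp, by simp only [hu]; ring⟩
    · exact ⟨-(e ⬝ᵥ (P⁻¹ *ᵥ Pi.single j 1)), _, Or.inr hu, by ring⟩
  set y : ι → ℂ := a • Pi.single i 1 + b • Pi.single j 1 with hy
  have hx : e ⬝ᵥ (P⁻¹ *ᵥ y) = 0 := by
    rw [hy, mulVec_add, mulVec_smul, mulVec_smul, dotProduct_add, dotProduct_smul,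
      dotProduct_smul, smul_eq_mul, smul_eq_mul, h0]
  have hnn := he _ hx
  rw [re_star_dotProduct_congr_diagonal_mulVec, mulVec_mulVec, hPP, one_mulVec] at hnn
  have hyi : y i = a := by simp [hy, hij]
  have hyj : y j = b := by simp [hy, Ne.symm hij]
  have hyk : ∀ k, k ≠ i → k ≠ j → y k = 0 := fun k hki hkj => by
    simp [hy, hki, hkj]
  have hle : ∀ k, d k * Complex.normSq (y k) ≤ 0 := fun k => by
    rcases eq_or_ne k i with rfl | hki
    · exact mul_nonpos_of_nonpos_of_nonneg hi.le (Complex.normSq_nonneg _)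
    rcases eq_or_ne k j with rfl | hkj
    · exact mul_nonpos_of_nonpos_of_nonneg hj.le (Complex.normSq_nonneg _)
    simp [hyk k hki hkj]
  refine absurd hnn (not_le.2 (Finset.sum_neg' (fun k _ => hle k) ?_))
  rcases hab with ha | hb
  · exact ⟨i, Finset.mem_univ i, mul_neg_of_neg_of_pos hi (Complex.normSq_pos.2 (hyi ▸ ha))⟩
  · exact ⟨j, Finset.mem_univ j, mul_neg_of_neg_of_pos hj (Complex.normSq_pos.2 (hyj ▸ hb))⟩

lemma PosDef.det_re_add_smul_ge (hA : A.PosDef) (hB : B.PosSemidef) {e : ι → ℂ}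
    (he : ∀ x, e ⬝ᵥ x = 0 → 0 ≤ (star x ⬝ᵥ ((A - B) *ᵥ x)).re) {t : ℝ} (ht : 0 ≤ t) :
    A.det.re + t * (A.det.re - (A - B).det.re) ≤ (A + t • B).det.re := by
  obtain ⟨P, d, hP, hd, rfl, rfl⟩ := hA.exists_congr_one_diagonal hB
  have hone := det_re_add_smul_congr_diagonal P d 0
  have hsub := add_smul_congr_diagonal P d (-1)
  have hneg := det_re_add_smul_congr_diagonal P d (-1)
  simp only [zero_smul, add_zero, zero_mul, Finset.prod_const_one, mul_one] at hone
  simp only [neg_smul, one_smul, ← sub_eq_add_neg, neg_mul, one_mul] at hneg hsub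
  rw [hsub] at he
  have hsingle : ∀ i j, 1 < d i → 1 < d j → i = j := fun i j hi hj =>
    eq_of_congr_diagonal_nonneg_on_hyperplane hP he (by linarith) (by linarith)
  have h1 := one_sub_sum_le_prod_one_sub_of_subsingleton d hd hsingle
  have h2 := one_add_sum_le_prod_one_add Finset.univ (fun i => t * d i)
    fun i _ => mul_nonneg ht (hd i)
  rw [← Finset.mul_sum] at h2
  rw [det_re_add_smul_congr_diagonal, hone, hneg]
  have hn := Complex.normSq_nonneg P.det
  have h3 : 1 + t * (1 - ∏ i, (1 - d i)) ≤ ∏ i, (1 + t * d i) := by nlinarith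
  nlinarith [mul_le_mul_of_nonneg_left h3 hn]

lemma PosSemidef.det_re_add_smul_ge (hA : A.PosSemidef) (hB : B.PosSemidef) {e : ι → ℂ}
    (he : ∀ x, e ⬝ᵥ x = 0 → 0 ≤ (star x ⬝ᵥ ((A - B) *ᵥ x)).re) {t : ℝ} (ht : 0 ≤ t) :
    A.det.re + t * (A.det.re - (A - B).det.re) ≤ (A + t • B).det.re := by
  have hcont : Continuous fun ε : ℝ => (A + ε • 1 + t • B).det.re -
      ((A + ε • 1).det.re + t * ((A + ε • 1).det.re - (A + ε • 1 - B).det.re)) := by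
    have h (C : Matrix ι ι ℂ) : Continuous fun ε : ℝ => (A + ε • 1 + C).det.re :=
      Complex.continuous_re.comp (by fun_prop)
    have h0 := h 0
    have h1 := h (-B)
    have h2 := h (t • B)
    simp only [add_zero, ← sub_eq_add_neg] at h0 h1
    fun_prop
  have hlim := (hcont.tendsto 0).mono_left (nhdsWithin_le_nhds (s := Set.Ioi 0))
  have hpos := ge_of_tendsto hlim <| by
    filter_upwards [self_mem_nhdsWithin] with ε (hε : 0 < ε)
    have hAε : (A + ε • 1).PosDef := PosDef.posSemidef_add hA (PosDef.one.smul hε)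
    refine sub_nonneg.2 (hAε.det_re_add_smul_ge hB (e := e) (fun x hx => ?_) ht)
    have hsplit : A + ε • 1 - B = (A - B) + ε • (1 : Matrix ι ι ℂ) := by abel
    have h1 : 0 ≤ (star x ⬝ᵥ ((ε • (1 : Matrix ι ι ℂ)) *ᵥ x)).re :=
      (PosSemidef.one.smul hε.le).re_dotProduct_nonneg x
    rw [hsplit, add_mulVec, dotProduct_add, Complex.add_re]
    exact add_nonneg (he x hx) h1
  simpa using hpos

/-- A lower bound for the growth of `t ↦ re det (A + t B)` bounds its derivative at `0`. -/
lemma le_deriv_det_re_add_smul {c : ℝ}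
    (h : ∀ t : ℝ, 0 < t → A.det.re + t * c ≤ (A + t • B).det.re) :
    c ≤ deriv (fun t : ℝ => (A + t • B).det.re) 0 := by
  have hdiff : DifferentiableAt ℝ (fun t : ℝ => (A + t • B).det.re) 0 := by
    have : DifferentiableAt ℝ (fun t : ℝ => (A + t • B).det) 0 := by
      simp only [det_apply, add_apply, smul_apply]
      fun_prop
    exact Complex.reCLM.differentiableAt.comp (0 : ℝ) this
  refine ge_of_tendsto hdiff.hasDerivAt.tendsto_slope_zero_right ?_
  filter_upwards [self_mem_nhdsWithin] with t (ht : 0 < t)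
  have := h t ht
  rw [smul_eq_mul, ← div_eq_inv_mul, le_div_iff₀ ht]
  simp only [zero_add, zero_smul, add_zero]
  linarith

lemma PosDef.sub_posDef_of_deriv_lt (hA : A.PosDef) (hB : B.PosSemidef)
    (h : deriv (fun t : ℝ => (A + t • B).det.re) 0 < A.det.re) : (A - B).PosDef := by
  obtain ⟨P, d, hP, hd, rfl, rfl⟩ := hA.exists_congr_one_diagonal hB
  have hone := det_re_add_smul_congr_diagonal P d 0
  have hsub := add_smul_congr_diagonal P d (-1)
  simp only [zero_smul, add_zero, zero_mul, Finset.prod_const_one, mul_one] at hone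
  simp only [neg_smul, one_smul, ← sub_eq_add_neg, neg_mul, one_mul] at hsub
  have hn := Complex.normSq_nonneg P.det
  have hlower := le_deriv_det_re_add_smul (A := Pᴴ * P)
    (B := Pᴴ * diagonal (fun i => (d i : ℂ)) * P) (c := Complex.normSq P.det * ∑ i, d i)
    fun t ht => by
      have h2 := one_add_sum_le_prod_one_add Finset.univ (fun i => t * d i)
        fun i _ => mul_nonneg ht.le (hd i)
      rw [← Finset.mul_sum] at h2
      rw [det_re_add_smul_congr_diagonal, hone]
      linarith [mul_le_mul_of_nonneg_left h2 hn]
  have hsum : ∑ i, d i < 1 := by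
    by_contra! hge
    nlinarith [mul_le_mul_of_nonneg_left hge hn]
  rw [hsub]
  refine (IsUnit.posDef_star_left_conjugate_iff hP).2 (posDef_diagonal_iff.2 fun i => ?_)
  have := Finset.single_le_sum (fun k _ => hd k) (Finset.mem_univ i)
  exact_mod_cast sub_pos.2 (this.trans_lt hsum)

end Matrix

/-- **Pointwise Morse inequality for `(1,1)`-forms.**

On a complex vector space `V ≅ ℂⁿ` with coordinates `z₁,…,z_n`, a positive
semidefinite Hermitian `(1,1)`-form `α = i ∑ A_{jk} dz_j ∧ dz̄_k` corresponds
to a positive semidefinite Hermitian matrix `A`.  Relative to the fixed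
positive volume form `τ = (i dz₁∧dz̄₁) ∧ ⋯ ∧ (i dz_n∧dz̄_n)` one has
`α^n = n!·(det A)·τ`, `(α-β)^n = n!·det(A-B)·τ`, and
`n·α^{n-1}∧β = n!·(d/dt|₀ det(A + tB))·τ`, so that
`α^n - n·α^{n-1}∧β = n!·(det A - d/dt|₀ det(A + tB))·τ`.  The eigenvalues of
the Hermitian form `α - β` are those of the Hermitian matrix `A - B`.

The statement: if `α - β` has at most one negative eigenvalue then
`(α-β)^n ≥ α^n - n·α^{n-1}∧β` (as multiples of `τ`), and if `α - β` has at
least two negative eigenvalues then `α^n - n·α^{n-1}∧β ≤ 0`.  Together these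
give the pointwise inequality
`1_{X(α-β,≤1)}·(α-β)^n ≥ α^n - n·α^{n-1}∧β` for positive `(1,1)`-forms. -/
theorem pointwise_morse_inequality (n : ℕ) (hn : 0 < n)
    (A B : Matrix (Fin n) (Fin n) ℂ) (hA : A.PosSemidef) (hB : B.PosSemidef) :
    (Nat.card {i : Fin n //
        (hA.isHermitian.sub hB.isHermitian).eigenvalues i < 0} ≤ 1 →
      (n.factorial : ℝ) * (A - B).det.re ≥
        (n.factorial : ℝ) *
          (A.det.re - deriv (fun t : ℝ => ((A + t • B).det).re) 0)) ∧
    (2 ≤ Nat.card {i : Fin n //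
        (hA.isHermitian.sub hB.isHermitian).eigenvalues i < 0} →
      (n.factorial : ℝ) *
          (A.det.re - deriv (fun t : ℝ => ((A + t • B).det).re) 0) ≤ 0) := by
  have hfac : (0 : ℝ) ≤ n.factorial := Nat.cast_nonneg _
  constructor
  · intro hcard
    obtain ⟨e, he⟩ :=
      (hA.isHermitian.sub hB.isHermitian).exists_re_nonneg_of_card_eigenvalues_neg_le_one hcard
    have h := Matrix.le_deriv_det_re_add_smul fun t ht => hA.det_re_add_smul_ge hB he (le_of_lt ht)
    exact mul_le_mul_of_nonneg_left (by linarith) hfac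
  · intro hcard
    refine mul_nonpos_of_nonneg_of_nonpos hfac (sub_nonpos.2 ?_)
    by_cases hdet : A.det = 0
    · have h := Matrix.le_deriv_det_re_add_smul (A := A) (B := B) (c := 0) fun t ht => by
        simpa [hdet] using (Complex.le_def.1 (hA.add (hB.smul ht.le)).det_nonneg).1
      simpa [hdet] using h
    · by_contra! hlt
      have hpos := (hA.posDef_iff_det_ne_zero.2 hdet).sub_posDef_of_deriv_lt hB hlt
      have : IsEmpty {i : Fin n // (hA.isHermitian.sub hB.isHermitian).eigenvalues i < 0} :=
        ⟨fun i => absurd i.2 (not_lt.2 (hpos.eigenvalues_pos i.1).le)⟩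
      simp at hcard
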